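/- Deadlock-freedom for CCSℓ: if Γ;ℝ ⊢ P and P →* P', then P' is not deadlocked. -/

import Mathlib

/-!  CCSℓ : an asynchronous CCS with lock names (Hirschkoff et al.). -/

namespace CCSL

/-- CCSℓ processes: acquire prefix, release, restriction, parallel. -/
inductive Proc : Type
  | acq : ℕ → Proc → Proc
  | rel : ℕ → Proc
  | nu  : ℕ → Proc → Proc
  | par : Proc → Proc → Proc
  deriving DecidableEq

namespace Proc

/-- Free lock names. -/
def fn : Proc → Finset ℕ
  | acq l P => insert l P.fn
  | rel l => {l}
  | nu l P => P.fn.erase l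
  | par P Q => P.fn ∪ Q.fn

end Proc

open Proc

/-- Structural congruence: least congruence with commutativity/associativity of `|`,
scope extrusion and exchange of restrictions. -/
inductive SC : Proc → Proc → Prop
  | refl (P) : SC P P
  | symm {P Q} : SC P Q → SC Q P
  | trans {P Q R} : SC P Q → SC Q R → SC P R
  | parComm (P Q) : SC (par P Q) (par Q P)
  | parAssoc (P Q R) : SC (par (par P Q) R) (par P (par Q R))
  | scopeExt {P Q : Proc} {l : ℕ} : l ∉ P.fn → SC (par P (nu l Q)) (nu l (par P Q))
  | nuComm (l l' : ℕ) (P) : SC (nu l (nu l' P)) (nu l' (nu l P))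
  | acqCong (l) {P Q} : SC P Q → SC (acq l P) (acq l Q)
  | nuCong (l) {P Q} : SC P Q → SC (nu l P) (nu l Q)
  | parCong {P P' Q Q'} : SC P P' → SC Q Q' → SC (par P Q) (par P' Q')

/-- Reduction: `ℓ̄ | ℓ.P → P`, closed under execution contexts and `≡`. -/
inductive Red : Proc → Proc → Prop
  | comm (l P) : Red (par (rel l) (acq l P)) P
  | parL {P P'} (Q) : Red P P' → Red (par P Q) (par P' Q)
  | nu (l) {P P'} : Red P P' → Red (nu l P) (nu l P')
  | struct {P Q Q' P'} : SC P Q → Red Q Q' → SC Q' P' → Red P P'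

/-- Reflexive transitive closure of reduction. -/
def RedStar : Proc → Proc → Prop := Relation.ReflTransGen Red

/-- Typing environments: finite sets of components (sets of lock names). -/
abbrev Env := Finset (Finset ℕ)

/-- Pairwise disjointness of the components of an environment. -/
def Env.WF (Γ : Env) : Prop := (↑Γ : Set (Finset ℕ)).Pairwise fun a b => Disjoint a b

/-- Definedness of the connect operation `γ ⌢ Γ`. -/
def connectOK (γ : Finset ℕ) (Γ : Env) : Prop := ∀ δ ∈ Γ, (γ ∩ δ).card ≤ 1

/-- The connect operation `γ ⌢ Γ`. -/
def connect (γ : Finset ℕ) (Γ : Env) : Env :=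
  Γ.filter (fun δ => γ ∩ δ = ∅) ∪
    {γ ∪ (Γ.filter (fun δ => γ ∩ δ ≠ ∅)).sup id}

/-- `Comp Γ₁ Γ₂ Δ` holds when the composition `Γ₁ ⊗ Γ₂` is defined and equals `Δ`:
`∅ ⊗ Γ' = Γ'` and `(Γ,γ) ⊗ Γ' = γ ⌢ (Γ ⊗ Γ')`. -/
inductive Comp : Env → Env → Env → Prop
  | nil (Γ) : Comp ∅ Γ Γ
  | cons {γ : Finset ℕ} {Γ Γ' Δ : Env} :
      γ ∉ Γ → Comp Γ Γ' Δ → connectOK γ Δ → Comp (insert γ Γ) Γ' (connect γ Δ)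

/-- The typing judgement `Γ ; ℝ ⊢ P` of CCSℓ. -/
inductive Typed : Env → Finset ℕ → Proc → Prop
  | acq {Γ : Env} {γ R : Finset ℕ} {l : ℕ} {P : Proc} :
      l ∉ γ → l ∉ R → insert l γ ∉ Γ → Env.WF (insert (insert l γ) Γ) →
      Typed (insert (insert l γ) Γ) (insert l R) P →
      Typed {Γ.sup id ∪ insert l γ} R (acq l P)
  | rel {Γ : Env} {γ : Finset ℕ} {l : ℕ} :
      l ∉ γ → insert l γ ∉ Γ → Env.WF (insert (insert l γ) Γ) →
      Typed (insert (insert l γ) Γ) {l} (rel l)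
  | nu {Γ : Env} {γ R : Finset ℕ} {l : ℕ} {P : Proc} :
      l ∉ γ → l ∉ R → insert l γ ∉ Γ → γ ∉ Γ → Env.WF (insert (insert l γ) Γ) →
      Typed (insert (insert l γ) Γ) (insert l R) P →
      Typed (insert γ Γ) R (nu l P)
  | par {Γ₁ Γ₂ Δ : Env} {R₁ R₂ : Finset ℕ} {P₁ P₂ : Proc} :
      Typed Γ₁ R₁ P₁ → Typed Γ₂ R₂ P₂ → Comp Γ₁ Γ₂ Δ → Disjoint R₁ R₂ →
      Typed Δ (R₁ ∪ R₂) (par P₁ P₂)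

/-- `(νℓ₁)…(νℓₖ)P`. -/
def nuList : List ℕ → Proc → Proc
  | [], P => P
  | l :: ls, P => nu l (nuList ls P)

/-- `ℓ̄ | ℓ̄₁ | … | ℓ̄ₙ` : a (nonempty) parallel composition of releases. -/
def relProd (l : ℕ) (ls : List ℕ) : Proc := ls.foldl (fun P x => par P (rel x)) (rel l)

/-- A process is complete if all its free lock names are available: `Γ ; fn(P) ⊢ P`. -/
def Complete (P : Proc) : Prop := ∃ Γ : Env, Typed Γ P.fn P

/-- `P` contains at least one acquire. -/
def hasAcq : Proc → Prop
  | acq _ _ => True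
  | rel _ => False
  | nu _ P => hasAcq P
  | par P Q => hasAcq P ∨ hasAcq Q

/-- A deadlocked process: a complete process that contains an acquire and cannot reduce. -/
def Deadlocked (P : Proc) : Prop := Complete P ∧ hasAcq P ∧ ¬ ∃ P', Red P P'

end CCSL

namespace CCSL

open Proc

namespace Proc

/-- Free lock names on which an unguarded acquire is pending. -/
def acqs : Proc → Finset ℕ
  | acq l _ => {l}
  | rel _ => ∅
  | nu l P => P.acqs.erase l
  | par P Q => P.acqs ∪ Q.acqs

/-- Free lock names of which an unguarded release is present. -/
def rels : Proc → Finset ℕ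
  | acq _ _ => ∅
  | rel l => {l}
  | nu l P => P.rels.erase l
  | par P Q => P.rels ∪ Q.rels

theorem acqs_subset_fn (P : Proc) : P.acqs ⊆ P.fn := by
  induction P with
  | acq l P _ => simp [acqs, fn]
  | rel l => simp [acqs]
  | nu l P ih => exact Finset.erase_subset_erase l ih
  | par P Q ihP ihQ => exact Finset.union_subset_union ihP ihQ

end Proc

theorem Red.parR (P : Proc) {Q Q' : Proc} (h : Red Q Q') : Red (par P Q) (par P Q') :=
  .struct (.parComm _ _) (.parL P h) (.parComm _ _)

/-- A release on `x` synchronises with any unguarded acquire on `x`. -/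
theorem exists_red_rel_par {x : ℕ} {P : Proc} (hx : x ∈ P.acqs) :
    ∃ P', Red (par (rel x) P) P' := by
  induction P with
  | acq l P _ =>
    obtain rfl : x = l := by simpa [acqs] using hx
    exact ⟨_, .comm x P⟩
  | rel l => simp [acqs] at hx
  | nu a P ih =>
    obtain ⟨hne, hx⟩ := Finset.mem_erase.1 hx
    obtain ⟨P', h⟩ := ih hx
    exact ⟨_, .struct (.scopeExt (by simpa [fn] using hne.symm)) (.nu a h) (.refl _)⟩
  | par P Q ihP ihQ =>
    rcases Finset.mem_union.1 hx with hx | hx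
    · obtain ⟨P', h⟩ := ihP hx
      exact ⟨_, .struct (.symm (.parAssoc _ _ _)) (.parL Q h) (.refl _)⟩
    · obtain ⟨Q', h⟩ := ihQ hx
      exact ⟨_, .struct (.trans (.parCong (.refl _) (.parComm P Q)) (.symm (.parAssoc _ _ _)))
        (.parL P h) (.refl _)⟩

/-- An unguarded release can be brought to the front of a typed term. -/
theorem Typed.sc_rel_par {Γ : Env} {R : Finset ℕ} {P : Proc} (hT : Typed Γ R P) {x : ℕ}
    (hx : x ∈ P.rels) : (P = Proc.rel x ∧ R = {x}) ∨ ∃ P₀, SC P (Proc.par (Proc.rel x) P₀) := by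
  induction hT with
  | acq => simp [rels] at hx
  | rel =>
    obtain rfl := Finset.mem_singleton.1 hx
    exact .inl ⟨rfl, rfl⟩
  | @nu Γ γ R a P _ _ _ _ _ _ ih =>
    obtain ⟨hne, hx⟩ := Finset.mem_erase.1 hx
    rcases ih hx with ⟨_, hR⟩ | ⟨P₀, h⟩
    · have : a ∈ ({x} : Finset ℕ) := hR ▸ Finset.mem_insert_self a R
      exact absurd (Finset.mem_singleton.1 this).symm hne
    · exact .inr ⟨_, .trans (.nuCong a h) (.symm (.scopeExt (by simpa [fn] using hne.symm)))⟩
  | @par Γ₁ Γ₂ Δ R₁ R₂ P₁ P₂ _ _ _ _ ih₁ ih₂ =>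
    right
    rcases Finset.mem_union.1 hx with hx | hx
    · rcases ih₁ hx with ⟨rfl, _⟩ | ⟨P₀, h⟩
      · exact ⟨_, .refl _⟩
      · exact ⟨_, .trans (.parCong h (.refl _)) (.parAssoc _ _ _)⟩
    · rcases ih₂ hx with ⟨rfl, _⟩ | ⟨P₀, h⟩
      · exact ⟨_, .parComm _ _⟩
      · exact ⟨_, .trans (.parComm _ _) (.trans (.parCong h (.refl _)) (.parAssoc _ _ _))⟩

theorem Typed.exists_red_par {Γ : Env} {R : Finset ℕ} {P Q : Proc} (hT : Typed Γ R P) {x : ℕ}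
    (hP : x ∈ P.rels) (hQ : x ∈ Q.acqs) : ∃ P', Red (Proc.par P Q) P' := by
  obtain ⟨Q', h⟩ := exists_red_rel_par hQ
  rcases hT.sc_rel_par hP with ⟨rfl, _⟩ | ⟨P₀, hP₀⟩
  · exact ⟨_, h⟩
  · exact ⟨_, .struct (.trans (.parCong hP₀ (.refl _)) (.trans (.parAssoc _ _ _)
      (.trans (.parCong (.refl _) (.parComm _ _)) (.symm (.parAssoc _ _ _)))))
      (.parL P₀ h) (.refl _)⟩

/-- A typed term in which a free lock is both released and acquired can reduce. -/
theorem Typed.exists_red {Γ : Env} {R : Finset ℕ} {P : Proc} (hT : Typed Γ R P) {x : ℕ}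
    (hr : x ∈ P.rels) (ha : x ∈ P.acqs) : ∃ P', Red P P' := by
  induction hT with
  | acq => simp [rels] at hr
  | rel => simp [acqs] at ha
  | @nu _ _ _ a _ _ _ _ _ _ _ ih =>
    obtain ⟨P', h⟩ := ih (Finset.mem_of_mem_erase hr) (Finset.mem_of_mem_erase ha)
    exact ⟨_, .nu a h⟩
  | @par Γ₁ Γ₂ Δ R₁ R₂ P₁ P₂ h₁ h₂ _ _ ih₁ ih₂ =>
    rcases Finset.mem_union.1 hr with hr | hr <;> rcases Finset.mem_union.1 ha with ha | ha
    · obtain ⟨P', h⟩ := ih₁ hr ha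
      exact ⟨_, .parL _ h⟩
    · exact h₁.exists_red_par hr ha
    · obtain ⟨P', h⟩ := h₂.exists_red_par hr ha
      exact ⟨_, .struct (.parComm _ _) h (.refl _)⟩
    · obtain ⟨P', h⟩ := ih₂ hr ha
      exact ⟨_, .parR _ h⟩

/-- Every lock of `R` lies in a component of `Γ`, and is either in `L` (released), or
shares each of its components with a lock of `A` (awaited) outside `R`. -/
structure Flow (A L : Finset ℕ) (Γ : Env) (R : Finset ℕ) : Prop where
  cover : ∀ x ∈ R, ∃ γ ∈ Γ, x ∈ γ
  next : ∀ γ ∈ Γ, ∀ x ∈ γ, x ∈ R → x ∈ L ∨ ∃ y ∈ γ, y ∉ R ∧ y ∈ A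

theorem Flow.mono {A A' L L' : Finset ℕ} {Γ : Env} {R : Finset ℕ} (h : Flow A L Γ R)
    (hA : A ⊆ A') (hL : L ⊆ L') : Flow A' L' Γ R where
  cover := h.cover
  next γ hγ x hx hR := (h.next γ hγ x hx hR).imp (@hL x)
    fun ⟨y, hy, hyR, hyA⟩ => ⟨y, hy, hyR, hA hyA⟩

theorem eq_of_connectOK {γ δ : Finset ℕ} {Γ : Env} (h : connectOK γ Γ) (hδ : δ ∈ Γ) {x y : ℕ}
    (hxγ : x ∈ γ) (hxδ : x ∈ δ) (hyγ : y ∈ γ) (hyδ : y ∈ δ) : x = y :=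
  Finset.card_le_one.1 (h δ hδ) x (Finset.mem_inter.2 ⟨hxγ, hxδ⟩) y (Finset.mem_inter.2 ⟨hyγ, hyδ⟩)

/-- Membership in the component created by connecting `γ` to `Γ`. -/
theorem mem_merged {γ : Finset ℕ} {Γ : Env} {x : ℕ} :
    x ∈ γ ∪ (Γ.filter (fun δ => γ ∩ δ ≠ ∅)).sup id ↔
      x ∈ γ ∨ ∃ δ ∈ Γ, (∃ z ∈ γ, z ∈ δ) ∧ x ∈ δ := by
  simp only [Finset.mem_union, Finset.mem_sup, Finset.mem_filter, id, ← Finset.nonempty_iff_ne_empty,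
    Finset.Nonempty, Finset.mem_inter, and_assoc]

theorem mem_connect {γ ε : Finset ℕ} {Γ : Env} :
    ε ∈ connect γ Γ ↔ (ε ∈ Γ ∧ ∀ x ∈ ε, x ∉ γ) ∨
      ε = γ ∪ (Γ.filter (fun δ => γ ∩ δ ≠ ∅)).sup id := by
  simp only [connect, Finset.mem_union, Finset.mem_filter, Finset.mem_singleton,
    ← Finset.disjoint_iff_inter_eq_empty, Finset.disjoint_right]

theorem Flow.connect {A L γ R S : Finset ℕ} {Γ : Env} (hAL : Disjoint A L) (h : Flow A L Γ R)
    (hS : S ⊆ γ) (hγ : ∀ x ∈ S, x ∈ L ∨ ∃ y ∈ γ, y ∉ S ∧ y ∈ A) (hok : connectOK γ Γ) :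
    Flow A L (connect γ Γ) (S ∪ R) where
  cover := by
    intro x hx
    rcases Finset.mem_union.1 hx with hx | hx
    · exact ⟨_, mem_connect.2 (.inr rfl), mem_merged.2 (.inl (hS hx))⟩
    · obtain ⟨δ, hδ, hxδ⟩ := h.cover x hx
      by_cases hz : ∃ z ∈ γ, z ∈ δ
      · exact ⟨_, mem_connect.2 (.inr rfl), mem_merged.2 (.inr ⟨δ, hδ, hz, hxδ⟩)⟩
      · exact ⟨δ, mem_connect.2 (.inl ⟨hδ, fun y hy hyγ => hz ⟨y, hyγ, hy⟩⟩), hxδ⟩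
  next := by
    have hnl : ∀ {y}, y ∈ A → y ∉ L := fun hA hL => Finset.disjoint_left.1 hAL hA hL
    -- from an awaited lock of `γ` outside `S`
    have out : ∀ y ∈ γ, y ∉ S → y ∈ A →
        ∃ z ∈ γ ∪ (Γ.filter (fun δ => γ ∩ δ ≠ ∅)).sup id, z ∉ S ∪ R ∧ z ∈ A := by
      intro y hyγ hyS hyA
      by_cases hyR : y ∈ R
      · obtain ⟨δ, hδ, hyδ⟩ := h.cover y hyR
        rcases h.next δ hδ y hyδ hyR with hL | ⟨z, hzδ, hzR, hzA⟩
        · exact absurd hL (hnl hyA)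
        · refine ⟨z, mem_merged.2 (.inr ⟨δ, hδ, ⟨y, hyγ, hyδ⟩, hzδ⟩), ?_, hzA⟩
          rw [Finset.mem_union, not_or]
          refine ⟨fun hzS => hzR ?_, hzR⟩
          exact eq_of_connectOK hok hδ hyγ hyδ (hS hzS) hzδ ▸ hyR
      · exact ⟨y, mem_merged.2 (.inl hyγ), by simp [hyS, hyR], hyA⟩
    have fromS : ∀ x ∈ S, x ∈ L ∨
        ∃ z ∈ γ ∪ (Γ.filter (fun δ => γ ∩ δ ≠ ∅)).sup id, z ∉ S ∪ R ∧ z ∈ A :=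
      fun x hx => (hγ x hx).imp_right fun ⟨y, hyγ, hyS, hyA⟩ => out y hyγ hyS hyA
    intro ε hε x hxε hx
    rcases mem_connect.1 hε with ⟨hεΓ, hd⟩ | rfl
    · rcases Finset.mem_union.1 hx with hx | hx
      · exact absurd (hS hx) (hd x hxε)
      · refine (h.next ε hεΓ x hxε hx).imp_right fun ⟨y, hy, hyR, hyA⟩ => ⟨y, hy, ?_, hyA⟩
        rw [Finset.mem_union, not_or]
        exact ⟨fun hyS => hd y hy (hS hyS), hyR⟩
    · rcases Finset.mem_union.1 hx with hx | hx
      · exact fromS x hx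
      · obtain ⟨δ, hδ, hz, hxδ⟩ : ∃ δ ∈ Γ, (∃ z ∈ γ, z ∈ δ) ∧ x ∈ δ := by
          rcases mem_merged.1 hxε with hxγ | h'
          · obtain ⟨δ, hδ, hxδ⟩ := h.cover x hx
            exact ⟨δ, hδ, ⟨x, hxγ, hxδ⟩, hxδ⟩
          · exact h'
        refine (h.next δ hδ x hxδ hx).imp_right fun ⟨y, hyδ, hyR, hyA⟩ => ?_
        by_cases hyS : y ∈ S
        · exact (fromS y hyS).resolve_left (hnl hyA)
        · exact ⟨y, mem_merged.2 (.inr ⟨δ, hδ, hz, hyδ⟩), by simp [hyS, hyR], hyA⟩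

theorem Flow.comp {A L R₁ R₂ : Finset ℕ} {Γ₁ Γ₂ Δ : Env} (hAL : Disjoint A L)
    (h₁ : Flow A L Γ₁ R₁) (h₂ : Flow A L Γ₂ R₂) (hc : Comp Γ₁ Γ₂ Δ) :
    Flow A L Δ (R₁ ∪ R₂) := by
  have key : Flow A L Δ (Γ₁.sup id ∩ R₁ ∪ R₂) := by
    replace h₁ := h₁.next
    induction hc with
    | nil => simpa using h₂
    | @cons γ Γ Γ' Δ _ _ hok ih =>
      have ih := ih h₂ fun δ hδ => h₁ δ (Finset.mem_insert_of_mem hδ)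
      have := Flow.connect (S := γ ∩ R₁) hAL ih Finset.inter_subset_left
        (fun x hx => (h₁ γ (Finset.mem_insert_self _ _) x (Finset.mem_inter.1 hx).1
          (Finset.mem_inter.1 hx).2).imp_right
            fun ⟨y, hy, hyR, hyA⟩ => ⟨y, hy, by simp [hyR], hyA⟩) hok
      rw [← Finset.union_assoc, ← Finset.union_inter_distrib_right] at this
      rwa [Finset.sup_insert]
  have hsub : R₁ ⊆ Γ₁.sup id := fun x hx => by
    obtain ⟨γ, hγ, hxγ⟩ := h₁.cover x hx
    exact Finset.mem_sup.2 ⟨γ, hγ, hxγ⟩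
  rwa [Finset.inter_eq_right.2 hsub] at key

theorem Typed.disjoint_of_stuck {Γ : Env} {R : Finset ℕ} {P : Proc} (hT : Typed Γ R P)
    (hs : ¬ ∃ P', Red P P') : Disjoint P.acqs P.rels :=
  Finset.disjoint_left.2 fun _ ha hr => hs (hT.exists_red hr ha)

theorem Typed.obligations_subset {Γ : Env} {R : Finset ℕ} {P : Proc} (hT : Typed Γ R P) :
    ∀ x ∈ R, x ∈ Γ.sup id := by
  induction hT with
  | acq _ _ _ _ _ ih =>
    intro x hx
    simpa [or_comm, or_left_comm, or_assoc] using ih x (Finset.mem_insert_of_mem hx)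
  | rel => simp
  | @nu _ _ _ l _ _ hR _ _ _ _ ih =>
    intro x hx
    have := ih x (Finset.mem_insert_of_mem hx)
    have hne : x ≠ l := fun h => hR (h ▸ hx)
    simpa [hne] using this
  | @par Γ₁ Γ₂ Δ R₁ R₂ _ _ _ _ hc _ ih₁ ih₂ =>
    have key : Γ₁.sup id ∪ Γ₂.sup id ⊆ Δ.sup id := by
      clear * - hc
      induction hc with
      | nil => simp
      | @cons γ Γ Γ' Δ _ _ _ ih =>
        have hsub : γ ∪ Δ.sup id ⊆ (connect γ Δ).sup id := by
          intro x hx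
          rw [Finset.mem_sup]
          rcases Finset.mem_union.1 hx with hx | hx
          · exact ⟨_, mem_connect.2 (.inr rfl), mem_merged.2 (.inl hx)⟩
          · obtain ⟨δ, hδ, hxδ⟩ := Finset.mem_sup.1 hx
            by_cases hz : ∃ z ∈ γ, z ∈ δ
            · exact ⟨_, mem_connect.2 (.inr rfl), mem_merged.2 (.inr ⟨δ, hδ, hz, hxδ⟩)⟩
            · exact ⟨δ, mem_connect.2 (.inl ⟨hδ, fun y hy hyγ => hz ⟨y, hyγ, hy⟩⟩), hxδ⟩
        refine subset_trans ?_ hsub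
        rw [Finset.sup_insert, id, Finset.sup_eq_union, Finset.union_assoc]
        exact Finset.union_subset_union_right ih
    intro x hx
    refine key ?_
    rcases Finset.mem_union.1 hx with hx | hx
    · exact Finset.mem_union_left _ (ih₁ x hx)
    · exact Finset.mem_union_right _ (ih₂ x hx)

theorem Typed.flow_of_stuck {Γ : Env} {R : Finset ℕ} {P : Proc} (hT : Typed Γ R P)
    (hs : ¬ ∃ P', Red P P') : Flow P.acqs P.rels Γ R := by
  induction hT with
  | @acq Γ γ R l P h1 h2 h3 h4 hP _ =>
    refine ⟨fun x hx => ?_, fun δ hδ x _ hxR => .inr ⟨l, ?_, h2, by simp [acqs]⟩⟩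
    · have := (Typed.acq h1 h2 h3 h4 hP).obligations_subset x hx
      simpa using this
    · rw [Finset.mem_singleton.1 hδ]
      simp
  | @rel Γ γ l =>
    refine ⟨fun x hx => ⟨_, Finset.mem_insert_self _ _, ?_⟩, fun δ _ x _ hx => .inl hx⟩
    rw [Finset.mem_singleton.1 hx]
    exact Finset.mem_insert_self _ _
  | @nu Γ γ R l P _ hlR _ _ _ _ ih =>
    have ih := ih fun ⟨P', h⟩ => hs ⟨_, .nu l h⟩
    have hne : ∀ {x}, x ∈ R → x ≠ l := fun hx h => hlR (h ▸ hx)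
    refine ⟨fun x hx => ?_, fun δ hδ x hxδ hx => ?_⟩
    · obtain ⟨δ, hδ, hxδ⟩ := ih.cover x (Finset.mem_insert_of_mem hx)
      rcases Finset.mem_insert.1 hδ with rfl | hδ
      · exact ⟨γ, Finset.mem_insert_self _ _, Finset.mem_of_mem_insert_of_ne hxδ (hne hx)⟩
      · exact ⟨δ, Finset.mem_insert_of_mem hδ, hxδ⟩
    · obtain ⟨δ', hδ', hsub, hsub'⟩ : ∃ δ' ∈ insert (insert l γ) Γ, δ ⊆ δ' ∧
          ∀ y ∈ δ', y ≠ l → y ∈ δ := by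
        rcases Finset.mem_insert.1 hδ with rfl | hδ
        · exact ⟨_, Finset.mem_insert_self _ _, Finset.subset_insert _ _,
            fun y hy hyl => Finset.mem_of_mem_insert_of_ne hy hyl⟩
        · exact ⟨δ, Finset.mem_insert_of_mem hδ, subset_rfl, fun y hy _ => hy⟩
      rcases ih.next δ' hδ' x (hsub hxδ) (Finset.mem_insert_of_mem hx) with h | ⟨y, hy, hyR, hyA⟩
      · exact .inl (Finset.mem_erase.2 ⟨hne hx, h⟩)
      · rw [Finset.mem_insert, not_or] at hyR
        exact .inr ⟨y, hsub' y hy hyR.1, hyR.2, Finset.mem_erase.2 ⟨hyR.1, hyA⟩⟩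
  | par h₁ h₂ hc hd ih₁ ih₂ =>
    have ih₁ := ih₁ fun ⟨P', h⟩ => hs ⟨_, .parL _ h⟩
    have ih₂ := ih₂ fun ⟨P', h⟩ => hs ⟨_, .parR _ h⟩
    exact .comp ((Typed.par h₁ h₂ hc hd).disjoint_of_stuck hs)
      (ih₁.mono Finset.subset_union_left Finset.subset_union_left)
      (ih₂.mono Finset.subset_union_right Finset.subset_union_right) hc

/-- A typed stuck term awaits a lock that it does not itself own. -/
theorem Typed.exists_awaited {Γ : Env} {R : Finset ℕ} {P : Proc} (hT : Typed Γ R P)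
    (hs : ¬ ∃ P', Red P P') (ha : hasAcq P) : ∃ y ∈ P.acqs, y ∉ R := by
  induction hT with
  | @acq _ _ _ l _ _ h2 => exact ⟨l, by simp [acqs], h2⟩
  | rel => exact ha.elim
  | @nu _ _ _ l _ _ _ _ _ _ _ ih =>
    obtain ⟨y, hy, hyR⟩ := ih (fun ⟨P', h⟩ => hs ⟨_, .nu l h⟩) ha
    rw [Finset.mem_insert, not_or] at hyR
    exact ⟨y, Finset.mem_erase.2 ⟨hyR.1, hy⟩, hyR.2⟩
  | @par Γ₁ Γ₂ Δ R₁ R₂ P₁ P₂ h₁ h₂ hc hd ih₁ ih₂ =>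
    have hT := Typed.par h₁ h₂ hc hd
    have hflow := hT.flow_of_stuck hs
    obtain ⟨y, hy⟩ : ∃ y, y ∈ (P₁.par P₂).acqs := by
      rcases ha with ha | ha
      · obtain ⟨y, hy, _⟩ := ih₁ (fun ⟨P', h⟩ => hs ⟨_, .parL _ h⟩) ha
        exact ⟨y, Finset.mem_union_left _ hy⟩
      · obtain ⟨y, hy, _⟩ := ih₂ (fun ⟨P', h⟩ => hs ⟨_, .parR _ h⟩) ha
        exact ⟨y, Finset.mem_union_right _ hy⟩
    by_cases hyR : y ∈ R₁ ∪ R₂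
    · obtain ⟨γ, hγ, hyγ⟩ := hflow.cover y hyR
      rcases hflow.next γ hγ y hyγ hyR with hL | ⟨z, _, hzR, hzA⟩
      · exact absurd hL (Finset.disjoint_left.1 (hT.disjoint_of_stuck hs) hy)
      · exact ⟨z, hzA, hzR⟩
    · exact ⟨y, hy, hyR⟩

end CCSL

open CCSL in
/-- Deadlock-freedom for CCSℓ: if `Γ;ℝ ⊢ P` and `P →* P'`,
then `P'` is not deadlocked. -/
theorem ccsl_deadlock_freedom
    (Γ : Env) (R : Finset ℕ) (P P' : Proc)
    (hT : Typed Γ R P) (hred : RedStar P P') : ¬ Deadlocked P' := by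
  rintro ⟨⟨Γ', hT'⟩, ha, hs⟩
  obtain ⟨y, hy, hyR⟩ := hT'.exists_awaited hs ha
  exact hyR (P'.acqs_subset_fn hy)
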